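/- Let θ > 0 and let f : ℝ → ℝ be differentiable. Define on (0,∞) the curve γ₁(t) = (t·cosh θ·cosh(tanh θ·ln t), t·cosh θ·sinh(tanh θ·ln t), f(t·cosh θ)), i.e. γ₁(t) = R₁(u(t), v(t)) with u(t) = t·cosh θ and v(t) = tanh θ·ln t. Then for every t > 0: (i) B(γ₁'(t), γ₁'(t)) = 1, i.e. (d/dt of the first component)² − (d/dt of the second component)² = 1, so γ₁ is a unit-speed space-like curve; and (ii) the pseudo-isotropic scalar product of γ₁'(t) with the tangent vector (cosh v(t), sinh v(t), f'(u(t))) of the meridian of R₁ through γ₁(t) equals cosh θ, i.e. (first component of γ₁'(t))·cosh(v(t)) − (second component of γ₁'(t))·sinh(v(t)) = cosh θ; since the meridian tangent satisfies B((cosh v, sinh v, f'(u)), (cosh v, sinh v, f'(u))) = 1, the curve γ₁ cuts all meridians of R₁ at the constant pseudo-isotropic angle θ. (Theorem 3.1: space-like loxodromes on rotational surfaces with space-like meridians.) -/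

import Mathlib

theorem hasDerivAt_tanh_mul_log (θ : ℝ) {t : ℝ} (ht : t ≠ 0) :
    HasDerivAt (fun s : ℝ => Real.tanh θ * Real.log s) (Real.tanh θ * t⁻¹) t :=
  (Real.hasDerivAt_log ht).const_mul _

theorem hasDerivAt_mul_cosh_mul_cosh_tanh_mul_log (θ : ℝ) {t : ℝ} (ht : t ≠ 0) :
    HasDerivAt (fun s : ℝ => s * Real.cosh θ * Real.cosh (Real.tanh θ * Real.log s))
      (Real.cosh θ * Real.cosh (Real.tanh θ * Real.log t)
        + Real.sinh θ * Real.sinh (Real.tanh θ * Real.log t)) t := by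
  have hc : Real.cosh θ ≠ 0 := (Real.cosh_pos θ).ne'
  refine (((hasDerivAt_id' t).mul_const (Real.cosh θ)).mul
    (hasDerivAt_tanh_mul_log θ ht).cosh).congr_deriv ?_
  rw [Real.tanh_eq_sinh_div_cosh]
  field_simp

theorem hasDerivAt_mul_cosh_mul_sinh_tanh_mul_log (θ : ℝ) {t : ℝ} (ht : t ≠ 0) :
    HasDerivAt (fun s : ℝ => s * Real.cosh θ * Real.sinh (Real.tanh θ * Real.log s))
      (Real.cosh θ * Real.sinh (Real.tanh θ * Real.log t)
        + Real.sinh θ * Real.cosh (Real.tanh θ * Real.log t)) t := by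
  have hc : Real.cosh θ ≠ 0 := (Real.cosh_pos θ).ne'
  refine (((hasDerivAt_id' t).mul_const (Real.cosh θ)).mul
    (hasDerivAt_tanh_mul_log θ ht).sinh).congr_deriv ?_
  rw [Real.tanh_eq_sinh_div_cosh]
  field_simp

/-- Theorem 3.1: the space-like loxodromes on the rotational surfaces with
space-like meridians `R₁(u,v) = (u cosh v, u sinh v, f(u))` in pseudo-isotropic
space.  The curve `γ₁(t) = R₁(t cosh θ, tanh θ · ln t)` is a unit-speed
space-like curve whose pseudo-isotropic scalar product with the unit space-like
meridian tangent `(cosh v(t), sinh v(t), f'(u(t)))` equals `cosh θ`, hence it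
cuts all meridians at the constant pseudo-isotropic angle `θ`. -/
theorem spacelike_loxodrome_spacelike_meridian
    (θ : ℝ) (hθ : 0 < θ) (f : ℝ → ℝ) (hf : Differentiable ℝ f) :
    ∀ t : ℝ, 0 < t →
      -- (i) γ₁ is unit-speed space-like: B(γ₁'(t), γ₁'(t)) = 1
      ((deriv (fun s : ℝ => s * Real.cosh θ * Real.cosh (Real.tanh θ * Real.log s)) t) ^ 2
        - (deriv (fun s : ℝ => s * Real.cosh θ * Real.sinh (Real.tanh θ * Real.log s)) t) ^ 2
          = 1) ∧
      -- (ii) B(γ₁'(t), β'(t)) = cosh θ, where β'(t) = (cosh v(t), sinh v(t), f'(u(t)))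
      ((deriv (fun s : ℝ => s * Real.cosh θ * Real.cosh (Real.tanh θ * Real.log s)) t)
          * Real.cosh (Real.tanh θ * Real.log t)
        - (deriv (fun s : ℝ => s * Real.cosh θ * Real.sinh (Real.tanh θ * Real.log s)) t)
          * Real.sinh (Real.tanh θ * Real.log t)
          = Real.cosh θ) ∧
      -- the meridian tangent is unit space-like: B(β'(t), β'(t)) = 1
      (Real.cosh (Real.tanh θ * Real.log t) ^ 2
        - Real.sinh (Real.tanh θ * Real.log t) ^ 2 = 1) := by
  intro t ht
  rw [(hasDerivAt_mul_cosh_mul_cosh_tanh_mul_log θ ht.ne').deriv,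
    (hasDerivAt_mul_cosh_mul_sinh_tanh_mul_log θ ht.ne').deriv]
  have hv := Real.cosh_sq_sub_sinh_sq (Real.tanh θ * Real.log t)
  refine ⟨?_, ?_, hv⟩
  · linear_combination
      (Real.cosh θ ^ 2 - Real.sinh θ ^ 2) * hv + Real.cosh_sq_sub_sinh_sq θ
  · linear_combination Real.cosh θ * hv
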